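/- arXiv:2303.05151 — 2 statements merged into one kernel-verified Lean document; each statement's English description precedes it below -/
import Mathlib

section
/- Let n ≥ 1 be an integer and let P ⊆ ℝ^d be a set of exactly n points such that ‖p − q‖₂² ≥ ln n for every two distinct points p, q ∈ P. Then for every p ∈ P, ∑_{q ∈ P} e^{−‖q − p‖₂²} ≤ 2; consequently, evaluating the ratio e^{−‖p − x‖₂²} / ∑_{q ∈ P} e^{−‖q − x‖₂²} at x = p gives a value at least 1/2, so the sensitivity s(p) = sup_{x ∈ ℝ^d} e^{−‖p − x‖₂²} / ∑_{q ∈ P} e^{−‖q − x‖₂²} is at least 1/2. -/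
theorem stmt_3 {d n : ℕ} (hn : 1 ≤ n) (P : Finset (EuclideanSpace ℝ (Fin d)))
    (hcard : P.card = n)
    (hsep : ∀ p ∈ P, ∀ q ∈ P, p ≠ q → Real.log n ≤ ‖p - q‖ ^ 2) :
    ∀ p ∈ P,
      (∑ q ∈ P, Real.exp (-‖q - p‖ ^ 2)) ≤ 2 ∧
      (1 / 2 : ℝ) ≤
        Real.exp (-‖p - p‖ ^ 2) / ∑ q ∈ P, Real.exp (-‖q - p‖ ^ 2) ∧
      (1 / 2 : ℝ) ≤
        ⨆ x : EuclideanSpace ℝ (Fin d),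
          Real.exp (-‖p - x‖ ^ 2) / ∑ q ∈ P, Real.exp (-‖q - x‖ ^ 2) := by
  classical
  intro p hp
  have hn0 : (0 : ℝ) < n := by exact_mod_cast hn
  have h1 : (∑ q ∈ P, Real.exp (-‖q - p‖ ^ 2)) ≤ 2 := by
    rw [← Finset.add_sum_erase P _ hp]
    have hb : ∑ q ∈ P.erase p, Real.exp (-‖q - p‖ ^ 2) ≤ ∑ q ∈ P.erase p, (n : ℝ)⁻¹ := by
      apply Finset.sum_le_sum
      intro q hq
      have hq' := Finset.mem_erase.mp hq
      have h := hsep q hq'.2 p hp hq'.1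
      calc Real.exp (-‖q - p‖ ^ 2) ≤ Real.exp (-Real.log n) := by
            apply Real.exp_le_exp.mpr
            linarith
        _ = (n : ℝ)⁻¹ := by rw [Real.exp_neg, Real.exp_log hn0]
    have hc : ∑ q ∈ P.erase p, (n : ℝ)⁻¹ ≤ 1 := by
      rw [Finset.sum_const, nsmul_eq_mul, ← div_eq_mul_inv, div_le_one hn0]
      have := Finset.card_erase_le (s := P) (a := p)
      rw [hcard] at this
      exact_mod_cast this
    have h0 : Real.exp (-‖p - p‖ ^ 2) = 1 := by simp
    rw [h0]
    linarith
  have hpos : ∀ x, 0 < ∑ q ∈ P, Real.exp (-‖q - x‖ ^ 2) := fun x =>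
    Finset.sum_pos (fun q _ => Real.exp_pos _) ⟨p, hp⟩
  have h2 : (1 / 2 : ℝ) ≤
        Real.exp (-‖p - p‖ ^ 2) / ∑ q ∈ P, Real.exp (-‖q - p‖ ^ 2) := by
    have h0 : Real.exp (-‖p - p‖ ^ 2) = 1 := by simp
    rw [h0]
    exact one_div_le_one_div_of_le (hpos p) h1
  refine ⟨h1, h2, h2.trans ?_⟩
  refine le_ciSup (f := fun x => Real.exp (-‖p - x‖ ^ 2) / ∑ q ∈ P, Real.exp (-‖q - x‖ ^ 2)) ?_ p
  refine ⟨1, ?_⟩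
  rintro _ ⟨x, rfl⟩
  refine (div_le_one (hpos x)).mpr ?_
  exact Finset.single_le_sum (f := fun q => Real.exp (-‖q - x‖ ^ 2))
    (fun q _ => (Real.exp_pos _).le) hp
end

section
/- Let P ⊆ ℝ^d be a finite nonempty set, let w : P → (0, ∞) be a positive weight function, and let B ≥ 0 be such that ‖q‖₂ ≤ B for every q ∈ P. Then for every p ∈ P and every x ∈ ℝ^d: w(p) e^{−‖p − x‖₂} / ∑_{q ∈ P} w(q) e^{−‖q − x‖₂} ≤ e^{‖p‖₂ + B} · w(p) / ∑_{q ∈ P} w(q). -/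
theorem stmt_10 {d : ℕ} (P : Finset (EuclideanSpace ℝ (Fin d))) (hP : P.Nonempty)
    (w : EuclideanSpace ℝ (Fin d) → ℝ) (hw : ∀ q ∈ P, 0 < w q)
    (B : ℝ) (hB : 0 ≤ B) (hbound : ∀ q ∈ P, ‖q‖ ≤ B) :
    ∀ p ∈ P, ∀ x : EuclideanSpace ℝ (Fin d),
      w p * Real.exp (-‖p - x‖) / ∑ q ∈ P, w q * Real.exp (-‖q - x‖) ≤
        Real.exp (‖p‖ + B) * w p / ∑ q ∈ P, w q := by
  intro p hp x
  have h1 : 0 < ∑ q ∈ P, w q * Real.exp (-‖q - x‖) :=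
    Finset.sum_pos (fun q hq => mul_pos (hw q hq) (Real.exp_pos _)) hP
  have h2 : 0 < ∑ q ∈ P, w q := Finset.sum_pos hw hP
  rw [div_le_div_iff₀ h1 h2]
  have key : Real.exp (-‖p - x‖) * ∑ q ∈ P, w q ≤
      Real.exp (‖p‖ + B) * ∑ q ∈ P, w q * Real.exp (-‖q - x‖) := by
    rw [Finset.mul_sum, Finset.mul_sum]
    refine Finset.sum_le_sum fun q hq => ?_
    have h3 : ‖q - x‖ ≤ ‖q - p‖ + ‖p - x‖ := norm_sub_le_norm_sub_add_norm_sub q p x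
    have h4 : ‖q - p‖ ≤ ‖q‖ + ‖p‖ := norm_sub_le q p
    have h5 := hbound q hq
    have h6 : Real.exp (-‖p - x‖) ≤ Real.exp (‖p‖ + B) * Real.exp (-‖q - x‖) := by
      rw [← Real.exp_add]
      exact Real.exp_le_exp.mpr (by linarith)
    have h7 := mul_le_mul_of_nonneg_left h6 (hw q hq).le
    linarith
  have h8 := mul_le_mul_of_nonneg_left key (hw p hp).le
  linarith
end
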